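/- Modal completeness of FOL□ with respect to theseshood: for every formula A of L(∀,□), either □A ∈ FOL□ or ¬□A ∈ FOL□. -/

import Mathlib

namespace FOLBoxPaper

/-- Formulas of the language L(∀,□): atoms `P_j(x₁,…,xₙ)` (predicate index and
list of variables), identity `x = y`, negation, implication, universal
quantification, and the modal operator □. Variables are natural numbers. -/
inductive Formula : Type
  | atom : ℕ → List ℕ → Formula
  | eq : ℕ → ℕ → Formula
  | neg : Formula → Formula
  | imp : Formula → Formula → Formula
  | all : ℕ → Formula → Formula
  | box : Formula → Formula

namespace Formula

/-- Conjunction, defined as usual. -/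
def and (A B : Formula) : Formula := neg (imp A (neg B))

/-- Disjunction, defined as usual. -/
def or (A B : Formula) : Formula := imp (neg A) B

/-- Biconditional, defined as usual. -/
def iff (A B : Formula) : Formula := (imp A B).and (imp B A)

/-- ◇A := ¬□¬A. -/
def dia (A : Formula) : Formula := neg (box (neg A))

/-- ∃xA := ¬∀x¬A. -/
def ex (x : ℕ) (A : Formula) : Formula := neg (all x (neg A))

/-- A formula is □-free when it contains no occurrence of □. -/
def BoxFree : Formula → Prop
  | atom _ _ => True
  | eq _ _ => True
  | neg A => BoxFree A
  | imp A B => BoxFree A ∧ BoxFree B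
  | all _ A => BoxFree A
  | box _ => False

/-- `FreeIn x A`: the variable x has at least one ∀□-free occurrence in A,
i.e. an occurrence that is neither in the scope of a quantifier binding x
nor in the scope of □. -/
def FreeIn (x : ℕ) : Formula → Prop
  | atom _ args => x ∈ args
  | eq a b => x = a ∨ x = b
  | neg A => FreeIn x A
  | imp A B => FreeIn x A ∨ FreeIn x B
  | all z A => z ≠ x ∧ FreeIn x A
  | box _ => False

/-- The ∀□-free substitution `A(y/x)`: replace every ∀□-free occurrence of x
in A by y (occurrences in the scope of □ or of a quantifier binding x are
left untouched). -/
def subst (A : Formula) (y x : ℕ) : Formula :=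
  match A with
  | atom j args => atom j (args.map fun z => if z = x then y else z)
  | eq a b => eq (if a = x then y else a) (if b = x then y else b)
  | neg A => neg (subst A y x)
  | imp A B => imp (subst A y x) (subst B y x)
  | all z A => if z = x then all z A else all z (subst A y x)
  | box A => box A

/-- `Substitutable y x A`: the variable y is substitutable for the ∀□-free
occurrences of x in A, i.e. y is not captured by a quantifier when it
replaces x. -/
def Substitutable (y x : ℕ) : Formula → Prop
  | atom _ _ => True
  | eq _ _ => True
  | neg A => Substitutable y x A
  | imp A B => Substitutable y x A ∧ Substitutable y x B
  | all z A => z = x ∨ ¬ FreeIn x A ∨ (z ≠ y ∧ Substitutable y x A)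
  | box _ => True

end Formula

open Formula

/-- A first-order structure with variable domains:
a nonempty set of possible worlds, a nonempty domain of objects for each
world, and a world-relative interpretation of the predicate symbols. -/
structure Structure where
  W : Type
  wNonempty : Nonempty W
  D : W → Type
  dNonempty : ∀ w, Nonempty (D w)
  I : ℕ → (w : W) → List (D w) → Prop

/-- A valuation assigns, to each variable and world, an object of the domain
of that world. -/
def Valuation (M : Structure) : Type := ℕ → (w : M.W) → M.D w

open Classical in
/-- The variant `v^a_x(w)` of a valuation v at world w: it maps x at w to a
and agrees with v everywhere else. -/
noncomputable def updateVal {M : Structure} (v : Valuation M) (x : ℕ)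
    (w : M.W) (a : M.D w) : Valuation M :=
  fun y w' => if h : y = x ∧ w' = w then cast (congrArg M.D h.2.symm) a else v y w'

/-- Satisfaction `M, v, w ⊨ A`. The clause for □ quantifies over all
valuations and all worlds of the structure. -/
def Sat (M : Structure) : Valuation M → M.W → Formula → Prop
  | v, w, .atom j args => M.I j w (args.map fun z => v z w)
  | v, w, .eq a b => v a w = v b w
  | v, w, .neg A => ¬ Sat M v w A
  | v, w, .imp A B => Sat M v w A → Sat M v w B
  | v, w, .all x A => ∀ a : M.D w, Sat M (updateVal v x w a) w A
  | _, _, .box A => ∀ (v' : Valuation M) (w' : M.W), Sat M v' w' A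

/-- `M ⊨ A`: A is satisfied at every valuation and world of M. -/
def Models (M : Structure) (A : Formula) : Prop := ∀ v w, Sat M v w A

/-- Universal structures: M is universal when every □-free formula true
everywhere in M is true everywhere in every structure. -/
def Universal (M : Structure) : Prop :=
  ∀ B, BoxFree B → Models M B → ∀ N : Structure, Models N B

/-- Logical validity: truth at every valuation and world of every universal
structure. -/
def Valid (A : Formula) : Prop :=
  ∀ M : Structure, Universal M → ∀ (v : Valuation M) (w : M.W), Sat M v w A

/-- FOL: the set of □-free classical first-order theses, i.e. □-free formulas
satisfied at every valuation and world of every structure. -/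
def FOL : Set Formula := {A | BoxFree A ∧ ∀ M : Structure, Models M A}

/-- `PropTaut A`: A is an instantiation of a tautology of classical
propositional logic (it is true under every assignment of truth values to
formulas that respects ¬ and →). -/
def PropTaut (A : Formula) : Prop :=
  ∀ f : Formula → Prop,
    (∀ B, f (neg B) ↔ ¬ f B) → (∀ B C, f (imp B C) ↔ (f B → f C)) → f A

/-- The system FOL□. -/
inductive FOLBox : Formula → Prop
  | taut {A} : PropTaut A → FOLBox A
  | axK {A B} : FOLBox ((box (A.imp B)).imp ((box A).imp (box B)))
  | axT {A} : FOLBox ((box A).imp A)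
  | ax5 {A} : FOLBox ((neg (box A)).imp (box (neg (box A))))
  | axAll1 {A : Formula} {x y : ℕ} : Substitutable y x A →
      FOLBox ((all x A).imp (A.subst y x))
  | axAll2 {A B : Formula} {x : ℕ} : ¬ FreeIn x A →
      FOLBox ((all x (A.imp B)).imp (A.imp (all x B)))
  | axId {x : ℕ} : FOLBox (Formula.eq x x)
  | axEq {A : Formula} {x y : ℕ} : BoxFree A → Substitutable y x A →
      FOLBox (((Formula.eq x y).and A).imp (A.subst y x))
  | axMix {A : Formula} {x : ℕ} : FOLBox ((box A).imp (all x A))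
  | axBang {A} : BoxFree A → A ∉ FOL → FOLBox (neg (box A))
  | mp {A B} : FOLBox (A.imp B) → FOLBox A → FOLBox B
  | nec {A} : FOLBox A → FOLBox (box A)

/-- The conjunction of a (nonempty) finite list of formulas. -/
def conjList : List Formula → Formula
  | [] => Formula.eq 0 0
  | [A] => A
  | A :: B :: rest => A.and (conjList (B :: rest))

/-- FOL□-consistency: no finite conjunction of members of Γ has its negation
in FOL□. -/
def Consistent (Γ : Set Formula) : Prop :=
  ∀ L : List Formula, L ≠ [] → (∀ B ∈ L, B ∈ Γ) → ¬ FOLBox (neg (conjList L))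

/-- Maximal FOL□-consistency. -/
def MaxConsistent (Γ : Set Formula) : Prop :=
  Consistent Γ ∧ ∀ A, A ∈ Γ ∨ neg A ∈ Γ

/-- ∃-saturation: whenever ¬∀xA ∈ Γ there is a variable y with
¬A(y/x) ∈ Γ via a ∀□-free substitution. -/
def Saturated (Γ : Set Formula) : Prop :=
  ∀ (x : ℕ) (A : Formula), neg (all x A) ∈ Γ →
    ∃ y : ℕ, Substitutable y x A ∧ neg (A.subst y x) ∈ Γ

/-- MC: the family of all ∃-saturated maximal FOL□-consistent sets. -/
def MC : Set (Set Formula) := {Γ | Saturated Γ ∧ MaxConsistent Γ}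

/-- An elementary disjunction: a formula of the form
`A ∨ ◇B ∨ □C₁ ∨ … ∨ □Cₙ` with A, B, C₁, …, Cₙ □-free. -/
def ElemDisj (D : Formula) : Prop :=
  ∃ (A B : Formula) (Cs : List Formula),
    BoxFree A ∧ BoxFree B ∧ (∀ C ∈ Cs, BoxFree C) ∧
    D = (Cs.map Formula.box).foldl Formula.or (A.or B.dia)

/-- A conjunctive form: a conjunction of elementary disjunctions. -/
def ConjForm (F : Formula) : Prop :=
  ∃ Ds : List Formula, Ds ≠ [] ∧ (∀ D ∈ Ds, ElemDisj D) ∧ F = conjList Ds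

/-- The worlds of the canonical structure: members of MC. -/
def MCW : Type := {Γ : Set Formula // Γ ∈ MC}

/-- The relation ∼_Γ on variables: x ∼_Γ y iff the formula x = y belongs
to Γ. -/
def canonRel (Γ : MCW) (x y : ℕ) : Prop := Formula.eq x y ∈ Γ.val

/-- The canonical structure 𝒜^MC: worlds are the members of MC, the domain
of a world Γ consists of the classes [x]_{∼_Γ} of variables, and a predicate
holds of such classes iff the corresponding atomic formula belongs to Γ. -/
noncomputable def canonicalStructure (h : Nonempty MCW) : Structure where
  W := MCW
  wNonempty := h
  D := fun Γ => Quot (canonRel Γ)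
  dNonempty := fun Γ => ⟨Quot.mk _ 0⟩
  I := fun j Γ ds =>
    ∃ xs : List ℕ, ds = xs.map (Quot.mk (canonRel Γ)) ∧ Formula.atom j xs ∈ Γ.val

/-- The canonical valuation v^MC: v^MC(x, Γ) = [x]_{∼_Γ}. -/
noncomputable def canonicalVal (h : Nonempty MCW) : Valuation (canonicalStructure h) :=
  fun x Γ => Quot.mk (canonRel Γ) x

namespace Formula

/-- A strict upper bound for all variables occurring in a formula. -/
def varBound : Formula → ℕ
  | atom _ args => args.sum + 1
  | eq a b => a + b + 1
  | neg A => varBound A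
  | imp A B => varBound A + varBound B
  | all z A => z + 1 + varBound A
  | box A => varBound A

/-- The number of connectives, quantifiers and atoms of a formula. -/
def size : Formula → ℕ
  | atom _ _ => 1
  | eq _ _ => 1
  | neg A => size A + 1
  | imp A B => size A + size B + 1
  | all _ A => size A + 1
  | box A => size A + 1

/-- A Gödel numbering of formulas. -/
def code : Formula → ℕ
  | atom j args => Nat.pair 0 (Nat.pair j (Encodable.encode args))
  | eq a b => Nat.pair 1 (Nat.pair a b)
  | neg A => Nat.pair 2 (code A)
  | imp A B => Nat.pair 3 (Nat.pair (code A) (code B))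
  | all z A => Nat.pair 4 (Nat.pair z (code A))
  | box A => Nat.pair 5 (code A)

theorem code_injective : Function.Injective code := by
  intro A
  induction A with
  | atom j args => intro B h; cases B <;> simp_all [code, Nat.pair_eq_pair]
  | eq a b => intro B h; cases B <;> simp_all [code, Nat.pair_eq_pair]
  | neg A ih =>
    intro B h
    cases B <;> simp [code, Nat.pair_eq_pair] at h ⊢
    exact ih h
  | imp A B ihA ihB =>
    intro C h
    cases C <;> simp [code, Nat.pair_eq_pair] at h ⊢
    exact ⟨ihA h.1, ihB h.2⟩
  | all z A ih =>
    intro B h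
    cases B <;> simp [code, Nat.pair_eq_pair] at h ⊢
    exact ⟨h.1, ih h.2⟩
  | box A ih =>
    intro B h
    cases B <;> simp [code, Nat.pair_eq_pair] at h ⊢
    exact ih h

instance : Countable Formula := code_injective.countable

instance : Nonempty Formula := ⟨eq 0 0⟩

theorem size_subst (A : Formula) (y x : ℕ) : (A.subst y x).size = A.size := by
  induction A with
  | all z A ih => simp only [subst]; split_ifs <;> simp [size, ih]
  | _ => simp_all [subst, size]

theorem BoxFree.subst {A : Formula} (h : A.BoxFree) (y x : ℕ) : (A.subst y x).BoxFree := by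
  induction A with
  | all z A ih =>
    simp only [Formula.subst]
    split_ifs
    · exact h
    · exact ih h
  | _ => simp_all [Formula.subst, BoxFree]

theorem subst_self (A : Formula) (x : ℕ) : A.subst x x = A := by
  have key : ∀ z : ℕ, (if z = x then x else z) = z := fun z => by split_ifs <;> simp_all
  induction A with
  | atom j args => simp only [subst, key, List.map_id']
  | _ => simp_all [subst]

theorem substitutable_self (A : Formula) (x : ℕ) : Substitutable x x A := by
  induction A with
  | all z A ih => simp only [Substitutable]; tauto
  | _ => simp_all [Substitutable]

theorem ne_of_mem_of_sum_lt {l : List ℕ} {y z : ℕ} (h : l.sum < y) (hz : z ∈ l) : z ≠ y := by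
  have := List.le_sum_of_mem hz
  omega

theorem not_freeIn_of_varBound_le {A : Formula} {y : ℕ} (h : A.varBound ≤ y) : ¬ FreeIn y A := by
  induction A with
  | atom j args => exact fun hy => ne_of_mem_of_sum_lt h hy rfl
  | eq a b => simp only [varBound, FreeIn] at *; omega
  | neg A ih => exact ih h
  | imp A B ihA ihB =>
    simp only [varBound, FreeIn] at *
    exact not_or.2 ⟨ihA (by omega), ihB (by omega)⟩
  | all z A ih =>
    simp only [varBound, FreeIn] at *
    exact fun hA => ih (by omega) hA.2
  | box A => exact id

theorem substitutable_of_varBound_le {A : Formula} {y : ℕ} (h : A.varBound ≤ y) (x : ℕ) :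
    Substitutable y x A := by
  induction A with
  | imp A B ihA ihB =>
    simp only [varBound] at h
    exact ⟨ihA (by omega), ihB (by omega)⟩
  | all z A ih =>
    simp only [varBound] at h
    exact .inr (.inr ⟨by omega, ih (by omega)⟩)
  | neg A ih => exact ih h
  | _ => trivial

theorem subst_eq_self_of_not_freeIn {A : Formula} {x : ℕ} (h : ¬ FreeIn x A) (y : ℕ) :
    A.subst y x = A := by
  induction A with
  | atom j args =>
    simp only [subst, FreeIn, atom.injEq, true_and] at *
    refine (List.map_congr_left fun z hz => ?_).trans (List.map_id _)
    rw [if_neg]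
    · rfl
    · rintro rfl
      exact h hz
  | eq a b => simp only [subst, FreeIn, not_or] at *; simp [Ne.symm h.1, Ne.symm h.2]
  | neg A ih => exact congrArg neg (ih h)
  | imp A B ihA ihB =>
    simp only [FreeIn, not_or] at h
    simp [subst, ihA h.1, ihB h.2]
  | all z A ih =>
    simp only [subst, FreeIn] at *
    split_ifs with hz
    · rfl
    · rw [ih fun hA => h ⟨hz, hA⟩]
  | box A => rfl

theorem subst_subst_cancel {A : Formula} {y : ℕ} (h : A.varBound ≤ y) (x : ℕ) :
    (A.subst y x).subst x y = A := by
  have key : ∀ z : ℕ, z ≠ y → (if (if z = x then y else z) = y then x else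
      (if z = x then y else z)) = z := by
    intro z hz
    split_ifs <;> simp_all
  induction A with
  | atom j args =>
    simp only [subst, List.map_map, atom.injEq, true_and]
    exact (List.map_congr_left fun z hz => key z (ne_of_mem_of_sum_lt h hz)).trans (List.map_id _)
  | eq a b =>
    simp only [varBound] at h
    simp only [subst]
    rw [key a (by omega), key b (by omega)]
  | neg A ih => exact congrArg neg (ih h)
  | imp A B ihA ihB =>
    simp only [varBound] at h
    simp only [subst]
    rw [ihA (by omega), ihB (by omega)]
  | all z A ih =>
    have hA : ¬ FreeIn y (all z A) := not_freeIn_of_varBound_le h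
    simp only [varBound] at h
    by_cases hz : z = x
    · rw [subst, if_pos hz, subst_eq_self_of_not_freeIn hA]
    · rw [subst, if_neg hz, subst, if_neg (by omega), ih (by omega)]
  | box A => rfl

theorem substitutable_subst {A : Formula} {y : ℕ} (h : A.varBound ≤ y) (x : ℕ) :
    Substitutable x y (A.subst y x) := by
  induction A with
  | imp A B ihA ihB =>
    simp only [varBound] at h
    exact ⟨ihA (by omega), ihB (by omega)⟩
  | all z A ih =>
    simp only [varBound] at h
    simp only [subst]
    split_ifs with hz
    · exact .inr (.inl (not_freeIn_of_varBound_le (by omega)))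
    · exact .inr (.inr ⟨hz, ih (by omega)⟩)
  | neg A ih => exact ih h
  | _ => trivial

theorem not_freeIn_subst (A : Formula) {x y : ℕ} (h : x ≠ y) : ¬ FreeIn x (A.subst y x) := by
  induction A with
  | atom j args =>
    simp only [subst, FreeIn, List.mem_map, not_exists, not_and]
    intro z _
    split_ifs with hz
    · exact h.symm
    · exact hz
  | eq a b => simp only [subst, FreeIn]; split_ifs <;> simp_all [eq_comm]
  | neg A ih => exact ih
  | imp A B ihA ihB => exact not_or.2 ⟨ihA, ihB⟩
  | all z A ih =>
    simp only [subst]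
    split_ifs with hz
    · exact fun hA => hA.1 hz
    · exact fun hA => ih hA.2
  | box A => exact id

end Formula

theorem updateVal_apply {M : Structure} (v : Valuation M) (x y : ℕ) (w : M.W) (a : M.D w) :
    updateVal v x w a y w = if y = x then a else v y w := by
  unfold updateVal
  split_ifs <;> simp_all

theorem updateVal_updateVal_same {M : Structure} (v : Valuation M) (x : ℕ) (w : M.W)
    (a b : M.D w) : updateVal (updateVal v x w a) x w b = updateVal v x w b := by
  funext y w'
  unfold updateVal
  split_ifs <;> simp_all

theorem updateVal_comm {M : Structure} (v : Valuation M) {x z : ℕ} (h : x ≠ z) (w : M.W)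
    (a b : M.D w) :
    updateVal (updateVal v x w a) z w b = updateVal (updateVal v z w b) x w a := by
  funext y w'
  unfold updateVal
  split_ifs with h₁ h₂
  · exact (h (h₂.1.symm.trans h₁.1)).elim
  all_goals rfl

theorem sat_subst {M : Structure} {w : M.W} {A : Formula} {x y : ℕ} (h : A.varBound ≤ y)
    (v : Valuation M) :
    Sat M v w (A.subst y x) ↔ Sat M (updateVal v x w (v y w)) w A := by
  have key : ∀ z, v (if z = x then y else z) w = updateVal v x w (v y w) z w := by
    intro z
    rw [updateVal_apply]
    split_ifs <;> rfl
  induction A generalizing v with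
  | atom j args =>
    simp only [subst, Sat, List.map_map]
    exact iff_of_eq (congrArg (M.I j w) (List.map_congr_left fun z _ => key z))
  | eq a b => simp only [subst, Sat, key]
  | neg A ih => exact not_congr (ih h v key)
  | imp A B ihA ihB =>
    simp only [varBound] at h
    exact imp_congr (ihA (by omega) v key) (ihB (by omega) v key)
  | all z A ih =>
    simp only [varBound] at h
    simp only [subst]
    split_ifs with hz
    · subst hz
      simp only [Sat, updateVal_updateVal_same]
    · simp only [Sat]
      refine forall_congr' fun a => ?_
      have hv : updateVal v z w a y w = v y w := by rw [updateVal_apply, if_neg (by omega)]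
      rw [updateVal_comm v (Ne.symm hz), ← hv]
      refine ih (by omega) _ fun u => ?_
      simp only [updateVal_apply]
      split_ifs <;> rfl
  | box A => exact Iff.rfl

namespace FOLBox

theorem mp_taut {A B : Formula} (h : FOLBox A) (t : PropTaut (A.imp B)) : FOLBox B :=
  mp (taut t) h

theorem mp_taut₂ {A B C : Formula} (hA : FOLBox A) (hB : FOLBox B)
    (t : PropTaut (A.imp (B.imp C))) : FOLBox C :=
  mp (mp (taut t) hA) hB

theorem imp_trans {A B C : Formula} (h₁ : FOLBox (A.imp B)) (h₂ : FOLBox (B.imp C)) :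
    FOLBox (A.imp C) :=
  mp_taut₂ h₁ h₂ fun f _ hi => by simp only [hi]; tauto

theorem gen {A : Formula} (x : ℕ) (h : FOLBox A) : FOLBox (all x A) := mp axMix (nec h)

theorem imp_all {A B : Formula} {x : ℕ} (hx : ¬ FreeIn x A) (h : FOLBox (A.imp B)) :
    FOLBox (A.imp (all x B)) := mp (axAll2 hx) (gen x h)

theorem all_imp_self (A : Formula) (x : ℕ) : FOLBox ((all x A).imp A) := by
  have := axAll1 (substitutable_self A x)
  rwa [subst_self] at this

theorem all_imp_all {A B : Formula} (x : ℕ) (h : FOLBox (A.imp B)) :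
    FOLBox ((all x A).imp (all x B)) :=
  imp_all (fun hx => hx.1 rfl) (imp_trans (all_imp_self A x) h)

theorem box_imp_box {A B : Formula} (h : FOLBox (A.imp B)) :
    FOLBox ((box A).imp (box B)) := mp axK (nec h)

theorem inst {A : Formula} {x y : ℕ} (hs : Substitutable y x A) (h : FOLBox A) :
    FOLBox (A.subst y x) := mp (axAll1 hs) (gen x h)

theorem all_subst_imp_all {A : Formula} {x y : ℕ} (hxy : x ≠ y) (h : A.varBound ≤ y) :
    FOLBox ((all y (A.subst y x)).imp (all x A)) := by
  refine imp_all (fun hx => not_freeIn_subst A hxy hx.2) ?_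
  have := axAll1 (substitutable_subst h x)
  rwa [subst_subst_cancel h] at this

theorem eq_symm (x y : ℕ) : FOLBox ((Formula.eq x y).imp (Formula.eq y x)) := by
  obtain ⟨u, hu⟩ : ∃ u, u = x + y + 1 := ⟨_, rfl⟩
  have h := inst (x := u) (y := x) (by simp [Formula.and, Formula.subst, Substitutable])
    (axEq (A := Formula.eq u x) (x := u) (y := y) trivial trivial)
  have hx : x ≠ u := by omega
  have hy : y ≠ u := by omega
  simp only [Formula.and, Formula.subst, if_true, if_neg hx, if_neg hy] at h
  exact mp_taut₂ h (axId (x := x)) fun f hn hi => by simp only [hn, hi]; tauto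

theorem eq_trans (x y z : ℕ) :
    FOLBox ((Formula.eq x y).imp ((Formula.eq y z).imp (Formula.eq x z))) := by
  by_cases hxy : x = y
  · subst hxy
    exact taut fun f _ hi => by simp only [hi]; tauto
  · have h := axEq (A := Formula.eq x y) (x := y) (y := z) trivial trivial
    simp only [Formula.and, Formula.subst, if_true, if_neg hxy] at h
    exact mp_taut h fun f hn hi => by simp only [hn, hi]; tauto

theorem atom_congr (j : ℕ) (p q : List ℕ) (x y : ℕ) :
    FOLBox ((Formula.eq x y).imp
      ((atom j (p ++ x :: q)).imp (atom j (p ++ y :: q)))) := by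
  obtain ⟨u, hu⟩ : ∃ u, u = p.sum + q.sum + x + y + 1 := ⟨_, rfl⟩
  have h := inst (x := u) (y := x) (by simp [Formula.and, Formula.subst, Substitutable])
    (axEq (A := atom j (p ++ u :: q)) (x := u) (y := y) trivial trivial)
  have hy : y ≠ u := by omega
  have fix : ∀ l : List ℕ, l.sum < u → ∀ y, l.map (fun z => if z = u then y else z) = l := by
    intro l hl y
    refine (List.map_congr_left fun z hz => ?_).trans (List.map_id _)
    rw [if_neg (ne_of_mem_of_sum_lt hl hz)]
    rfl
  have hp := fix p (by omega)
  have hq := fix q (by omega)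
  simp only [Formula.and, Formula.subst, List.map_append, List.map_cons, hp, hq, if_true,
    if_neg hy] at h
  exact mp_taut h fun f hn hi => by simp only [hn, hi]; tauto

end FOLBox

/-- A Henkin theory: a consistent, complete, deductively closed set of formulas in which every
negated universal formula has a witness beyond all the variables of that formula. -/
structure HenkinTheory (Γ : Set Formula) : Prop where
  mem_of_provable : ∀ {A}, FOLBox A → A ∈ Γ
  mp : ∀ {A B}, Formula.imp A B ∈ Γ → A ∈ Γ → B ∈ Γ
  neg_mem_iff : ∀ {A}, neg A ∈ Γ ↔ A ∉ Γ
  exists_witness : ∀ {x A}, neg (all x A) ∈ Γ →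
    ∃ y, (all x A).varBound ≤ y ∧ neg (A.subst y x) ∈ Γ

namespace HenkinTheory

variable {Γ : Set Formula}

theorem eq_symm (h : HenkinTheory Γ) {x y : ℕ} (hxy : Formula.eq x y ∈ Γ) :
    Formula.eq y x ∈ Γ := h.mp (h.mem_of_provable (FOLBox.eq_symm x y)) hxy

/-- Provable equality in a Henkin theory, as an equivalence relation on variables. -/
def setoid (h : HenkinTheory Γ) : Setoid ℕ where
  r x y := Formula.eq x y ∈ Γ
  iseqv :=
    { refl := fun _ => h.mem_of_provable FOLBox.axId
      symm := h.eq_symm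
      trans := fun h₁ h₂ => h.mp (h.mp (h.mem_of_provable (FOLBox.eq_trans _ _ _)) h₁) h₂ }

/-- The one-world term structure of a Henkin theory. -/
def termStructure (h : HenkinTheory Γ) : Structure where
  W := Unit
  wNonempty := ⟨()⟩
  D := fun _ => Quotient h.setoid
  dNonempty := fun _ => ⟨Quotient.mk _ 0⟩
  I := fun j _ ds => ∃ xs : List ℕ, ds = xs.map (Quotient.mk h.setoid) ∧ atom j xs ∈ Γ

/-- The valuation sending each variable to its class. -/
def termVal (h : HenkinTheory Γ) : Valuation h.termStructure := fun x _ => Quotient.mk h.setoid x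

theorem atom_mem_of_map_eq (h : HenkinTheory Γ) {j : ℕ} (xs ys p : List ℕ)
    (hxy : xs.map (Quotient.mk h.setoid) = ys.map (Quotient.mk h.setoid))
    (hx : atom j (p ++ xs) ∈ Γ) : atom j (p ++ ys) ∈ Γ := by
  induction xs generalizing ys p with
  | nil =>
    obtain rfl : ys = [] := by simpa using hxy.symm
    exact hx
  | cons x xs ih =>
    cases ys with
    | nil => simp at hxy
    | cons y ys =>
      simp only [List.map_cons, List.cons.injEq] at hxy
      have he : Formula.eq x y ∈ Γ := Quotient.exact hxy.1
      have := h.mp (h.mp (h.mem_of_provable (FOLBox.atom_congr j p xs x y)) he) hx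
      simpa using ih ys (p ++ [y]) hxy.2 (by simpa using this)

theorem exists_eq_ge (h : HenkinTheory Γ) (y n : ℕ) : ∃ z, n ≤ z ∧ Formula.eq z y ∈ Γ := by
  obtain ⟨u, hu⟩ : ∃ u, u = n + y + 1 := ⟨_, rfl⟩
  have hy : y ≠ u := by omega
  have hall := FOLBox.axAll1 (A := neg (Formula.eq u y)) (x := u) (y := y) trivial
  simp only [Formula.subst, if_true, if_neg hy] at hall
  obtain ⟨z, hz, hmem⟩ := h.exists_witness (h.mem_of_provable
    (FOLBox.mp_taut₂ hall (FOLBox.axId (x := y)) fun f hn hi => by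
      simp only [hn, hi]; tauto : FOLBox (neg (all u (neg (Formula.eq u y))))))
  simp only [Formula.subst, if_true, if_neg hy, h.neg_mem_iff, not_not] at hmem
  simp only [varBound] at hz
  exact ⟨z, by omega, hmem⟩

theorem sat_iff_mem (h : HenkinTheory Γ) (n : ℕ) (A : Formula) (hn : A.size ≤ n)
    (hA : A.BoxFree) : Sat h.termStructure h.termVal () A ↔ A ∈ Γ := by
  induction n generalizing A with
  | zero => cases A <;> simp [size] at hn
  | succ n ih =>
    cases A with
    | atom j args =>
      constructor
      · rintro ⟨xs, hxs, hmem⟩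
        exact h.atom_mem_of_map_eq xs args [] hxs.symm hmem
      · exact fun hmem => ⟨args, rfl, hmem⟩
    | eq a b => exact ⟨fun hab => Quotient.exact hab, fun hab => Quotient.sound hab⟩
    | neg A =>
      simp only [size] at hn
      exact (not_congr (ih A (by omega) hA)).trans h.neg_mem_iff.symm
    | imp A B =>
      simp only [size] at hn
      refine (imp_congr (ih A (by omega) hA.1) (ih B (by omega) hA.2)).trans
        ⟨fun hAB => ?_, h.mp⟩
      by_cases hmem : A ∈ Γ
      · refine h.mp (h.mem_of_provable (.taut fun f _ hi => ?_)) (hAB hmem)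
        simp only [hi]; tauto
      · refine h.mp (h.mem_of_provable (.taut fun f hn hi => ?_)) (h.neg_mem_iff.2 hmem)
        simp only [hn, hi]; tauto
    | all x A =>
      simp only [size] at hn
      have ihs : ∀ y, A.varBound ≤ y →
          (Sat h.termStructure (updateVal h.termVal x () (h.termVal y ())) () A ↔
            A.subst y x ∈ Γ) := fun y hy =>
        (sat_subst hy _).symm.trans (ih _ (by rw [size_subst]; omega) (BoxFree.subst (A := A) hA y x))
      constructor
      · intro hsat
        by_contra hmem
        obtain ⟨y, hy, hw⟩ := h.exists_witness (h.neg_mem_iff.2 hmem)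
        simp only [varBound] at hy
        exact h.neg_mem_iff.1 hw ((ihs y (by omega)).1 (hsat _))
      · intro hmem a
        obtain ⟨y, rfl⟩ := Quotient.exists_rep a
        obtain ⟨z, hz, hzy⟩ := h.exists_eq_ge y A.varBound
        have hcls : Quotient.mk h.setoid z = Quotient.mk h.setoid y := Quotient.sound hzy
        have := (ihs z hz).2
          (h.mp (h.mem_of_provable (.axAll1 (substitutable_of_varBound_le hz x))) hmem)
        rwa [show h.termVal z () = Quotient.mk h.setoid y from hcls] at this
    | box A => exact hA.elim

end HenkinTheory

/-- A witnessing instance for a negated universal formula, beyond a given variable `y`;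
other formulas are returned unchanged. -/
def henkinWitness (y : ℕ) : Formula → Formula
  | neg (all x A) => neg (A.subst y x)
  | B => B

open Classical in
/-- One step of the Henkin construction: adjoin `B`, with a fresh witness, to the finite theory
generated by `C`, if this is consistent. -/
noncomputable def henkinStep (C B : Formula) : Formula :=
  if FOLBox (neg (C.and B)) then C
  else (C.and B).and (henkinWitness (C.and B).varBound B)

theorem not_provable_neg_and_witness {C B : Formula} {y : ℕ} (hy : (C.and B).varBound ≤ y)
    (h : ¬ FOLBox (neg (C.and B))) : ¬ FOLBox (neg ((C.and B).and (henkinWitness y B))) := by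
  intro hw
  unfold henkinWitness at hw
  split at hw
  · rename_i x A
    refine h ?_
    have hfree : ¬ FreeIn y (C.and (neg (all x A))) := not_freeIn_of_varBound_le hy
    simp only [Formula.and, varBound] at hy
    have himp : FOLBox ((C.and (neg (all x A))).imp (A.subst y x)) :=
      FOLBox.mp_taut hw fun f hn hi => by simp only [Formula.and, hn, hi]; tauto
    have := FOLBox.imp_trans (FOLBox.imp_all hfree himp)
      (FOLBox.all_subst_imp_all (by omega) (by omega))
    exact FOLBox.mp_taut this fun f hn hi => by simp only [Formula.and, hn, hi]; tauto
  · exact h (FOLBox.mp_taut hw fun f hn hi => by simp only [Formula.and, hn, hi]; tauto)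

theorem henkinStep_consistent {C : Formula} (B : Formula) (h : ¬ FOLBox (neg C)) :
    ¬ FOLBox (neg (henkinStep C B)) := by
  unfold henkinStep
  split_ifs with hB
  · exact h
  · exact not_provable_neg_and_witness le_rfl hB

theorem henkinStep_imp (C B : Formula) : FOLBox ((henkinStep C B).imp C) := by
  unfold henkinStep
  split_ifs <;> exact .taut fun f hn hi => by simp only [Formula.and, hn, hi]; tauto

theorem exists_henkinTheory {C : Formula} (hC : ¬ FOLBox (neg C)) :
    ∃ Γ, HenkinTheory Γ ∧ C ∈ Γ := by
  obtain ⟨e, he⟩ := exists_surjective_nat Formula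
  let S : ℕ → Formula := fun n => n.rec C fun k D => henkinStep D (e k)
  have hcons : ∀ n, ¬ FOLBox (neg (S n)) := by
    intro n
    induction n with
    | zero => exact hC
    | succ n ih => exact henkinStep_consistent _ ih
  have hmono : ∀ m n, m ≤ n → FOLBox ((S n).imp (S m)) := by
    intro m n hmn
    induction n, hmn using Nat.le_induction with
    | base => exact .taut fun f _ hi => by simp only [hi]; tauto
    | succ n _ ih => exact FOLBox.imp_trans (henkinStep_imp _ _) ih
  have hmp : ∀ {A B}, (∃ n, FOLBox ((S n).imp (A.imp B))) → (∃ n, FOLBox ((S n).imp A)) →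
      ∃ n, FOLBox ((S n).imp B) := by
    rintro A B ⟨m, hm⟩ ⟨n, hn⟩
    refine ⟨max m n, FOLBox.mp_taut₂ (FOLBox.imp_trans (hmono _ _ (le_max_left m n)) hm)
      (FOLBox.imp_trans (hmono _ _ (le_max_right m n)) hn) fun f _ hi => ?_⟩
    simp only [hi]; tauto
  have hincons : ∀ {A}, (∃ n, FOLBox ((S n).imp (neg A))) → ¬ ∃ n, FOLBox ((S n).imp A) := by
    rintro A ⟨m, hm⟩ ⟨n, hn⟩
    refine hcons (max m n) (FOLBox.mp_taut₂ (FOLBox.imp_trans (hmono _ _ (le_max_left m n)) hm)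
      (FOLBox.imp_trans (hmono _ _ (le_max_right m n)) hn) fun f hn hi => ?_)
    simp only [hn, hi]; tauto
  have hstep : ∀ B, (∃ n, FOLBox ((S n).imp (neg B))) ∨
      ∃ n y, B.varBound ≤ y ∧ FOLBox ((S n).imp (B.and (henkinWitness y B))) := by
    intro B
    obtain ⟨k, rfl⟩ := he B
    by_cases hk : FOLBox (neg ((S k).and (e k)))
    · exact .inl ⟨k, FOLBox.mp_taut hk fun f hn hi => by
        simp only [Formula.and, hn, hi]; tauto⟩
    · refine .inr ⟨k + 1, ((S k).and (e k)).varBound, ?_, ?_⟩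
      · simp only [Formula.and, varBound]; omega
      · have : S (k + 1) =
            ((S k).and (e k)).and (henkinWitness ((S k).and (e k)).varBound (e k)) := if_neg hk
        rw [this]
        exact .taut fun f hn hi => by simp only [Formula.and, hn, hi]; tauto
  refine ⟨{B | ∃ n, FOLBox ((S n).imp B)}, ⟨?_, hmp, ?_, ?_⟩, 0, ?_⟩
  · exact fun h => ⟨0, FOLBox.mp_taut h fun f _ hi => by simp only [hi]; tauto⟩
  · intro A
    refine ⟨hincons, fun hA => (hstep A).resolve_right ?_⟩
    rintro ⟨n, y, -, h⟩
    exact hA ⟨n, FOLBox.mp_taut h fun f hn hi => by simp only [Formula.and, hn, hi]; tauto⟩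
  · intro x A hA
    rcases hstep (neg (all x A)) with h | ⟨n, y, hy, h⟩
    · exact (hincons h hA).elim
    · exact ⟨y, hy, n, FOLBox.mp_taut h fun f hn hi => by
        simp only [Formula.and, henkinWitness, hn, hi]; tauto⟩
  · exact .taut fun f _ hi => by simp only [hi]; tauto

/-- Gödel completeness of FOL□ for □-free formulas. -/
theorem provable_of_mem_FOL {A : Formula} (h : A ∈ FOL) : FOLBox A := by
  by_contra hA
  obtain ⟨Γ, hΓ, hmem⟩ := exists_henkinTheory (C := neg A) fun hnn =>
    hA (FOLBox.mp_taut hnn fun f hn hi => by simp only [hn, hi]; tauto)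
  exact hΓ.neg_mem_iff.1 hmem ((hΓ.sat_iff_mem _ A le_rfl h.1).1 (h.2 _ _ _))

theorem box_or_neg_box_of_equiv {A B : Formula} (hB : B.BoxFree) (h₁ : FOLBox (A.imp B))
    (h₂ : FOLBox (B.imp A)) : FOLBox (box A) ∨ FOLBox (neg (box A)) := by
  by_cases h : B ∈ FOL
  · exact .inl (.nec (.mp h₂ (provable_of_mem_FOL h)))
  · exact .inr (FOLBox.mp_taut₂ (FOLBox.box_imp_box h₁) (.axBang hB h) fun f hn hi => by
      simp only [hn, hi]; tauto)

theorem exists_boxFree_equiv (A : Formula) :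
    ∃ B, B.BoxFree ∧ FOLBox (A.imp B) ∧ FOLBox (B.imp A) := by
  have hrefl : ∀ A : Formula, FOLBox (A.imp A) := fun A => .taut fun f _ hi => by
    simp only [hi]; tauto
  induction A with
  | atom j args => exact ⟨atom j args, trivial, hrefl _, hrefl _⟩
  | eq a b => exact ⟨Formula.eq a b, trivial, hrefl _, hrefl _⟩
  | neg A ih =>
    obtain ⟨B, hB, h₁, h₂⟩ := ih
    refine ⟨neg B, hB, FOLBox.mp_taut h₂ fun f hn hi => ?_, FOLBox.mp_taut h₁ fun f hn hi => ?_⟩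
    all_goals simp only [hn, hi]; tauto
  | imp A A' ih ih' =>
    obtain ⟨B, hB, h₁, h₂⟩ := ih
    obtain ⟨B', hB', h₁', h₂'⟩ := ih'
    refine ⟨B.imp B', ⟨hB, hB'⟩, FOLBox.mp_taut₂ h₂ h₁' fun f hn hi => ?_,
      FOLBox.mp_taut₂ h₁ h₂' fun f hn hi => ?_⟩
    all_goals simp only [hi]; tauto
  | all x A ih =>
    obtain ⟨B, hB, h₁, h₂⟩ := ih
    exact ⟨all x B, hB, FOLBox.all_imp_all x h₁, FOLBox.all_imp_all x h₂⟩
  | box A ih =>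
    obtain ⟨B, hB, h₁, h₂⟩ := ih
    have hid : FOLBox (Formula.eq 0 0) := .axId
    rcases box_or_neg_box_of_equiv hB h₁ h₂ with h | h
    · refine ⟨Formula.eq 0 0, trivial, FOLBox.mp_taut hid fun f _ hi => ?_,
        FOLBox.mp_taut h fun f _ hi => ?_⟩
      all_goals simp only [hi]; tauto
    · refine ⟨neg (Formula.eq 0 0), trivial, FOLBox.mp_taut h fun f hn hi => ?_,
        FOLBox.mp_taut hid fun f hn hi => ?_⟩
      all_goals simp only [hn, hi]; tauto

/-- Modal completeness of FOL□ w.r.t. theseshood: for every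
formula A, either □A ∈ FOL□ or ¬□A ∈ FOL□. -/
theorem box_or_negbox (A : Formula) :
    FOLBox (Formula.box A) ∨ FOLBox (Formula.neg (Formula.box A)) := by
  obtain ⟨B, hB, h₁, h₂⟩ := exists_boxFree_equiv A
  exact box_or_neg_box_of_equiv hB h₁ h₂

end FOLBoxPaper
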